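/- arXiv:2405.12898 — 3 statements merged into one kernel-verified Lean document; each statement's English description precedes it below -/
import Mathlib

section
/- Let (V, ω) be a multisymplectic vector space of order k, and let U, W ⊆ V be subspaces such that U is k-isotropic, W is 1-isotropic, and V = U ⊕ W (internal direct sum). Then U is k-Lagrangian and W is 1-Lagrangian; that is, U^{⊥,k} ⊆ U + ker ♭₁ (hence U^{⊥,k} + ker ♭₁ = U + ker ♭₁) and W^{⊥,1} = W + ker ♭₁. -/
open Module

section Prelim

variable {V : Type*} [AddCommGroup V] [Module ℝ V] {k : ℕ}

theorem cons_curry (ω : AlternatingMap ℝ V ℝ (Fin (k+1))) (v : V) (u : Fin k → V) :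
    ω (Fin.cons v u) = ω.curryLeft v u := rfl

/-- The `j`-th multisymplectic orthogonal `W^{⊥,j}` of a subspace `W` with respect to the
`(k+1)`-form `ω`: the set of `v` such that `ω (v, w₁, …, w_j, u₁, …, u_{k-j}) = 0`
whenever `w₁, …, w_j ∈ W` (encoded by requiring the first `j` of the remaining `k`
arguments to lie in `W`). -/
def mPerp (ω : AlternatingMap ℝ V ℝ (Fin (k+1))) (W : Submodule ℝ V) (j : ℕ) :
    Submodule ℝ V where
  carrier := {v | ∀ u : Fin k → V, (∀ i : Fin k, (i : ℕ) < j → u i ∈ W) → ω (Fin.cons v u) = 0}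
  add_mem' := by
    intro a b ha hb u hu
    rw [cons_curry, map_add, AlternatingMap.add_apply, ← cons_curry, ← cons_curry,
      ha u hu, hb u hu, add_zero]
  zero_mem' := by
    intro u hu
    rw [cons_curry, map_zero, AlternatingMap.zero_apply]
  smul_mem' := by
    intro c x hx u hu
    rw [cons_curry, map_smul, AlternatingMap.smul_apply, ← cons_curry, hx u hu, smul_zero]

end Prelim

/-- An alternating form vanishes if it vanishes on tuples from `U` and on all tuples with some
entry in `W`, where `U` and `W` span. -/
theorem AlternatingMap.eq_zero_of_sup_eq_top {V : Type*} [AddCommGroup V] [Module ℝ V]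
    {ι : Type*} [Fintype ι] (η : AlternatingMap ℝ V ℝ ι) {U W : Submodule ℝ V}
    (h : U ⊔ W = ⊤) (hU : ∀ v : ι → V, (∀ i, v i ∈ U) → η v = 0)
    (hW : ∀ v : ι → V, ∀ i, v i ∈ W → η v = 0) : η = 0 := by
  classical
  ext v
  have hv : ∀ i, ∃ a ∈ U, ∃ b ∈ W, a + b = v i := fun i =>
    Submodule.mem_sup.1 (h ▸ Submodule.mem_top)
  choose a ha b hb hab using hv
  obtain rfl : a + b = v := funext hab
  change η.toMultilinearMap (a + b) = 0
  rw [MultilinearMap.map_add_univ]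
  refine Finset.sum_eq_zero fun s _ => ?_
  by_cases hs : ∀ i, i ∈ s
  · exact hU _ fun i => by simpa [hs i] using ha i
  · push Not at hs
    obtain ⟨i, hi⟩ := hs
    exact hW _ i (by simpa [hi] using hb i)

theorem curryLeft_eq_zero_of_mem_mPerp_one {V : Type*} [AddCommGroup V] [Module ℝ V] {k : ℕ}
    {ω : AlternatingMap ℝ V ℝ (Fin (k+1))} {W : Submodule ℝ V} {x : V}
    (hx : x ∈ mPerp ω W 1) (u : Fin k → V) (i : Fin k) (hi : u i ∈ W) :
    ω.curryLeft x u = 0 := by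
  have hk : 0 < k := i.pos
  have key : ω.curryLeft x (u ∘ Equiv.swap ⟨0, hk⟩ i) = 0 := by
    refine hx _ fun j hj => ?_
    obtain rfl : j = ⟨0, hk⟩ := Fin.ext (by simpa using hj)
    simpa using hi
  rw [AlternatingMap.map_perm] at key
  rcases Int.units_eq_one_or (Equiv.Perm.sign (Equiv.swap ⟨0, hk⟩ i)) with h | h <;>
    simpa [h] using key

theorem ker_curryLeft_le_mPerp {V : Type*} [AddCommGroup V] [Module ℝ V] {k : ℕ}
    (ω : AlternatingMap ℝ V ℝ (Fin (k+1))) (W : Submodule ℝ V) (j : ℕ) :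
    LinearMap.ker ω.curryLeft ≤ mPerp ω W j := by
  intro x hx u _
  rw [cons_curry, LinearMap.mem_ker.1 hx, AlternatingMap.zero_apply]

/-- A vector lying in both `U^{⊥,k}` and `W^{⊥,1}` is in the kernel of the contraction map. -/
theorem mPerp_inf_mPerp_one_le_ker {V : Type*} [AddCommGroup V] [Module ℝ V] {k : ℕ}
    (ω : AlternatingMap ℝ V ℝ (Fin (k+1))) {U W : Submodule ℝ V} (h : U ⊔ W = ⊤) :
    mPerp ω U k ⊓ mPerp ω W 1 ≤ LinearMap.ker ω.curryLeft := fun _ hx =>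
  LinearMap.mem_ker.2 <| AlternatingMap.eq_zero_of_sup_eq_top _ h
    (fun u hu => hx.1 u fun i _ => hu i) (curryLeft_eq_zero_of_mem_mPerp_one hx.2)

/-- If `V = U ⊕ W` with `U` `k`-isotropic and `W` `1`-isotropic, then `U` is `k`-Lagrangian
and `W` is `1`-Lagrangian: `U^{⊥,k} ⊆ U + ker ♭₁` (hence `U^{⊥,k} + ker ♭₁ = U + ker ♭₁`)
and `W^{⊥,1} = W + ker ♭₁`. -/
theorem isotropic_decomposition {V : Type*} [AddCommGroup V] [Module ℝ V]
    [FiniteDimensional ℝ V] {k : ℕ} (hk : 1 ≤ k) (ω : AlternatingMap ℝ V ℝ (Fin (k+1)))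
    (U W : Submodule ℝ V) (hU : U ≤ mPerp ω U k) (hW : W ≤ mPerp ω W 1)
    (hcompl : IsCompl U W) :
    mPerp ω U k ≤ U ⊔ LinearMap.ker ω.curryLeft
    ∧ mPerp ω U k ⊔ LinearMap.ker ω.curryLeft = U ⊔ LinearMap.ker ω.curryLeft
    ∧ mPerp ω W 1 = W ⊔ LinearMap.ker ω.curryLeft := by
  have hsup := hcompl.sup_eq_top
  have hker := mPerp_inf_mPerp_one_le_ker ω hsup
  have hUle : mPerp ω U k ≤ U ⊔ LinearMap.ker ω.curryLeft := by
    intro v hv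
    obtain ⟨a, ha, b, hb, rfl⟩ := Submodule.mem_sup.1 (hsup ▸ Submodule.mem_top : v ∈ U ⊔ W)
    exact Submodule.add_mem_sup ha
      (hker ⟨(Submodule.add_mem_iff_right _ (hU ha)).1 hv, hW hb⟩)
  refine ⟨hUle, le_antisymm (sup_le hUle le_sup_right) (sup_le_sup_right hU _),
    le_antisymm ?_ (sup_le hW (ker_curryLeft_le_mPerp ω W 1))⟩
  intro v hv
  obtain ⟨a, ha, b, hb, rfl⟩ := Submodule.mem_sup.1 (hsup ▸ Submodule.mem_top : v ∈ U ⊔ W)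
  rw [add_comm]
  exact Submodule.add_mem_sup hb
    (hker ⟨hU ha, (Submodule.add_mem_iff_left _ (hW hb)).1 hv⟩)
end

section
/- Let (V, ω, W, E) be a multisymplectic vector space of type (k, r): ω is non-degenerate, W ⊆ V is a 1-Lagrangian subspace, E ⊆ V/W is a subspace such that ι_{v₁∧⋯∧v_r} ω = 0 whenever π(v_i) ∈ E for all i (π : V → V/W the projection), and dim W = dim ⋀ᵏ_r (V/W)* (vertical forms with respect to E). Then there exists a k-Lagrangian subspace U ⊆ V that is a complement to W, i.e. V = U ⊕ W. -/
open Module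

section Vertical

variable {L : Type*} [AddCommGroup L] [Module ℝ L]

/-- The space `⋀ᵏ_r L*` of alternating `k`-forms on `L` vanishing whenever `r` of their
arguments belong to the subspace `E` (for `r = 0` this is all of `⋀ᵏ L*`). -/
noncomputable def verticalForms (k r : ℕ) (E : Submodule ℝ L) :
    Submodule ℝ (AlternatingMap ℝ L ℝ (Fin k)) :=
  if r = 0 then ⊤ else
  { carrier := {α | ∀ v : Fin k → L, (∀ i : Fin k, (i : ℕ) < r → v i ∈ E) → α v = 0}
    add_mem' := by intro a b ha hb v hv; simp [ha v hv, hb v hv]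
    zero_mem' := by intro v hv; simp
    smul_mem' := by intro c x hx v hv; simp [hx v hv] }

end Vertical

section Complement

variable {V : Type*} [AddCommGroup V] [Module ℝ V] {k : ℕ}

/-- Two slots in a subspace contained in its own `1`-orthogonal annihilate the form. -/
theorem apply_eq_zero_of_two_mem {ω : AlternatingMap ℝ V ℝ (Fin (k + 1))} {W : Submodule ℝ V}
    (hW : W ≤ mPerp ω W 1) (p : Fin (k + 1) → V) {i j : Fin (k + 1)} (hij : i ≠ j)
    (hi : p i ∈ W) (hj : p j ∈ W) : ω p = 0 := by
  obtain _ | k := k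
  · exact absurd (Subsingleton.elim (α := Fin 1) i j) hij
  · obtain ⟨σ, h0, h1⟩ : ∃ σ : Equiv.Perm (Fin (k + 1 + 1)), σ 0 = i ∧ σ 1 = j := by
      refine ⟨Equiv.swap (Equiv.swap 0 i 1) j * Equiv.swap 0 i, ?_, ?_⟩
      · rw [Equiv.Perm.mul_apply, Equiv.swap_apply_left, Equiv.swap_apply_of_ne_of_ne _ hij]
        intro h
        have : Equiv.swap 0 i 0 = Equiv.swap 0 i 1 := by rw [Equiv.swap_apply_left]; exact h
        simpa using (Equiv.swap 0 i).injective this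
      · simp
    have hperm := ω.map_perm p σ
    have hz : ω (p ∘ σ) = 0 := by
      rw [← Fin.cons_self_tail (p ∘ σ)]
      refine hW (by simpa [h0] using hi) (Fin.tail (p ∘ σ)) fun m hm => ?_
      obtain rfl : m = 0 := Fin.ext (Nat.lt_one_iff.1 hm)
      simpa [Fin.tail, h1] using hj
    rw [hz] at hperm
    exact (smul_eq_zero_iff_eq _).1 hperm.symm

/-- Perturbing arguments within `W` changes the form only to first order. -/
theorem apply_add_eq_add_sum {ω : AlternatingMap ℝ V ℝ (Fin (k + 1))} {W : Submodule ℝ V}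
    (hW : W ≤ mPerp ω W 1) (p q : Fin (k + 1) → V) (hq : ∀ i, q i ∈ W) :
    ω (p + q) = ω p + ∑ i, ω (Function.update p i (q i)) := by
  classical
  have hexp := ω.toMultilinearMap.map_add_univ q p
  simp only [AlternatingMap.coe_multilinearMap] at hexp
  rw [add_comm p q, hexp,
    ← Finset.sum_subset (Finset.subset_univ
      (insert ∅ (Finset.univ.image fun i : Fin (k + 1) => ({i} : Finset (Fin (k + 1))))))]
  · rw [Finset.sum_insert (by simp), Finset.sum_image Finset.singleton_injective.injOn]
    simp [Finset.piecewise_singleton]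
  · intro s _ hs
    simp only [Finset.mem_insert, Finset.mem_image, Finset.mem_univ, true_and, not_or,
      not_exists] at hs
    have hne : s.Nonempty := Finset.nonempty_iff_ne_empty.2 hs.1
    obtain ⟨i, hi⟩ := hne
    obtain ⟨j, hj, hji⟩ : ∃ j ∈ s, j ≠ i := by
      by_contra! h
      exact hs.2 i (Finset.eq_singleton_iff_unique_mem.2 ⟨hi, h⟩).symm
    exact apply_eq_zero_of_two_mem hW _ hji (by simpa [hj] using hq j) (by simpa [hi] using hq i)

/-- If `ι_x ω` and `ι_y ω` agree on a family closed under reindexing, so do the contractions in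
any other slot. -/
theorem apply_update_congr {L : Type*} (ω : AlternatingMap ℝ V ℝ (Fin (k + 1))) (s : L → V)
    {x y : V} (h : ∀ v : Fin k → L, ω (Fin.cons x (s ∘ v)) = ω (Fin.cons y (s ∘ v)))
    (l : Fin (k + 1) → L) (i : Fin (k + 1)) :
    ω (Function.update (s ∘ l) i x) = ω (Function.update (s ∘ l) i y) := by
  have key : ∀ z, Function.update (s ∘ l) i z ∘ Equiv.swap 0 i =
      Fin.cons z (s ∘ Fin.tail (l ∘ Equiv.swap 0 i)) := by
    intro z
    rw [← Fin.cons_self_tail (Function.update (s ∘ l) i z ∘ Equiv.swap 0 i)]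
    congr 1
    · simp
    · funext m
      have hne : Equiv.swap 0 i m.succ ≠ i := by
        rw [Ne, Equiv.swap_apply_eq_iff, Equiv.swap_apply_right]
        exact Fin.succ_ne_zero m
      simp [Fin.tail, Function.update_of_ne hne]
  have hx := ω.map_perm (Function.update (s ∘ l) i x) (Equiv.swap 0 i)
  have hy := ω.map_perm (Function.update (s ∘ l) i y) (Equiv.swap 0 i)
  rw [key] at hx hy
  rw [h, hy] at hx
  exact (smul_left_cancel _ hx).symm

/-- The map `V → ⋀ᵏ L*` contracting `ω` and pulling back along `s`. -/
noncomputable def contractPullback {L : Type*} [AddCommGroup L] [Module ℝ L]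
    (ω : AlternatingMap ℝ V ℝ (Fin (k + 1))) (s : L →ₗ[ℝ] V) :
    V →ₗ[ℝ] AlternatingMap ℝ L ℝ (Fin k) where
  toFun v := (ω.curryLeft v).compLinearMap s
  map_add' _ _ := by ext; simp
  map_smul' _ _ := by ext; simp

theorem contractPullback_apply {L : Type*} [AddCommGroup L] [Module ℝ L]
    (ω : AlternatingMap ℝ V ℝ (Fin (k + 1))) (s : L →ₗ[ℝ] V) (x : V) (v : Fin k → L) :
    contractPullback ω s x v = ω (Fin.cons x (s ∘ v)) := rfl

theorem mem_verticalForms {L : Type*} [AddCommGroup L] [Module ℝ L] {r : ℕ} {E : Submodule ℝ L}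
    {α : AlternatingMap ℝ L ℝ (Fin k)}
    (h : ∀ v : Fin k → L, (∀ i : Fin k, (i : ℕ) < r → v i ∈ E) → α v = 0) :
    α ∈ verticalForms k r E := by
  unfold verticalForms
  split_ifs
  · trivial
  · exact h

variable {W : Submodule ℝ V} {ω : AlternatingMap ℝ V ℝ (Fin (k + 1))}

theorem eq_zero_of_contractPullback_eq_zero (hnd : Function.Injective ω.curryLeft)
    (hW : W ≤ mPerp ω W 1) {s : (V ⧸ W) →ₗ[ℝ] V} (hs : ∀ x, W.mkQ (s x) = x) {w : V}
    (hw : w ∈ W) (h : contractPullback ω s w = 0) : w = 0 := by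
  apply hnd
  rw [map_zero]
  ext v
  have hv : ∀ i, v i - s (W.mkQ (v i)) ∈ W := fun i => by
    refine (Submodule.Quotient.mk_eq_zero W).1 ?_
    change W.mkQ _ = 0
    rw [map_sub, hs, sub_self]
  let q : Fin (k + 1) → V := Fin.cons 0 fun i => v i - s (W.mkQ (v i))
  have hq : ∀ i, q i ∈ W := Fin.cases W.zero_mem hv
  have hadd : (Fin.cons w v : Fin (k + 1) → V) = Fin.cons w (s ∘ (W.mkQ ∘ v)) + q := by
    funext i
    refine Fin.cases ?_ (fun i => ?_) i <;> simp [q]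
  have hzero : ω (Fin.cons w (s ∘ (W.mkQ ∘ v))) = 0 := by
    rw [← contractPullback_apply, h, AlternatingMap.zero_apply]
  rw [← cons_curry, hadd, apply_add_eq_add_sum hW _ _ hq, hzero, zero_add,
    AlternatingMap.zero_apply]
  refine Finset.sum_eq_zero fun i _ => ?_
  refine Fin.cases ?_ (fun i => ?_) i
  · exact ω.map_coord_zero 0 (by simp [q])
  · refine apply_eq_zero_of_two_mem hW _ (Fin.succ_ne_zero i) (by simpa using hq i.succ) ?_
    rw [Function.update_of_ne (Fin.succ_ne_zero i).symm]
    exact hw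

/-- Splittings of `V → V ⧸ W` can be corrected by any vertical-form-valued contraction. -/
theorem exists_section_apply_eq [FiniteDimensional ℝ V] {r : ℕ} {E : Submodule ℝ (V ⧸ W)}
    (hnd : Function.Injective ω.curryLeft) (hW : W ≤ mPerp ω W 1)
    (hE : ∀ p : Fin (k + 1) → V, (∀ i : Fin (k + 1), (i : ℕ) < r → W.mkQ (p i) ∈ E) → ω p = 0)
    (hdim : finrank ℝ W = finrank ℝ (verticalForms k r E))
    {s : (V ⧸ W) →ₗ[ℝ] V} (hs : ∀ x, W.mkQ (s x) = x) (B : (V ⧸ W) →ₗ[ℝ] (V ⧸ W))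
    (hB : ∀ x, contractPullback ω s (s (B x)) ∈ verticalForms k r E) (c : ℝ) :
    ∃ t : (V ⧸ W) →ₗ[ℝ] V, (∀ x, W.mkQ (t x) = x) ∧ ∀ l : Fin (k + 1) → V ⧸ W,
      ω (t ∘ l) = ω (s ∘ l) + c * ∑ i, ω (Function.update (s ∘ l) i (s (B (l i)))) := by
  have hmem : ∀ w : W, contractPullback ω s w ∈ verticalForms k r E := fun w =>
    mem_verticalForms fun v hv => hE _ <| Fin.cases
      (fun _ => by simp [(Submodule.Quotient.mk_eq_zero W).2 w.2]) fun i hi => by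
        simpa only [Fin.cons_succ, Function.comp_apply, hs] using hv i (by simp at hi; omega)
  let Θ : W →ₗ[ℝ] verticalForms k r E :=
    ((contractPullback ω s).comp W.subtype).codRestrict _ hmem
  have hΘ : Function.Injective Θ := (injective_iff_map_eq_zero Θ).2 fun w hw =>
    Subtype.ext <| eq_zero_of_contractPullback_eq_zero hnd hW hs w.2 (congrArg Subtype.val hw)
  have : FiniteDimensional ℝ (AlternatingMap ℝ (V ⧸ W) ℝ (Fin k)) :=
    FiniteDimensional.of_injective (AlternatingMap.toMultilinearMapLM (S := ℝ))
      AlternatingMap.coe_multilinearMap_injective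
  let e : W ≃ₗ[ℝ] verticalForms k r E :=
    LinearMap.linearEquivOfInjective (K := ℝ) (V := W) (V₂ := verticalForms k r E) Θ hΘ hdim
  let T : (V ⧸ W) →ₗ[ℝ] verticalForms k r E :=
    ((contractPullback ω s).comp (s.comp B)).codRestrict _ hB
  let A : (V ⧸ W) →ₗ[ℝ] W := c • e.symm.toLinearMap.comp T
  have hA : ∀ x, contractPullback ω s (A x) = contractPullback ω s (c • s (B x)) := fun x => by
    have h : Θ (A x) = c • T x := by
      change e (c • e.symm (T x)) = c • T x
      rw [map_smul, e.apply_symm_apply]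
    rw [map_smul]
    exact congrArg Subtype.val h
  refine ⟨s + W.subtype.comp A, fun x => ?_, fun l => ?_⟩
  · have hA0 : W.mkQ (A x : V) = 0 := (Submodule.Quotient.mk_eq_zero W).2 (A x).2
    change W.mkQ (s x + (A x : V)) = x
    rw [map_add, hs, hA0, add_zero]
  · have hsum : (s + W.subtype.comp A : (V ⧸ W) →ₗ[ℝ] V) ∘ l =
        s ∘ l + fun i => (A (l i) : V) := rfl
    rw [hsum, apply_add_eq_add_sum hW _ _ fun i => (A (l i)).2, Finset.mul_sum]
    congr 1
    refine Finset.sum_congr rfl fun i _ => ?_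
    rw [apply_update_congr ω s (y := c • s (B (l i))) (fun v => ?_) l i, ω.map_update_smul,
      smul_eq_mul]
    exact DFunLike.congr_fun (hA (l i)) v

/-- There is a splitting all of whose contractions with `ω` are vertical forms. -/
theorem exists_section_contractPullback_mem [FiniteDimensional ℝ V] {r : ℕ}
    {E : Submodule ℝ (V ⧸ W)} (hk : 1 ≤ k)
    (hnd : Function.Injective ω.curryLeft) (hW : W ≤ mPerp ω W 1)
    (hE : ∀ p : Fin (k + 1) → V, (∀ i : Fin (k + 1), (i : ℕ) < r → W.mkQ (p i) ∈ E) → ω p = 0)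
    (hdim : finrank ℝ W = finrank ℝ (verticalForms k r E)) :
    ∃ s : (V ⧸ W) →ₗ[ℝ] V, (∀ x, W.mkQ (s x) = x) ∧
      ∀ x, contractPullback ω s (s x) ∈ verticalForms k r E := by
  obtain ⟨s, hs⟩ := W.mkQ.exists_rightInverse_of_surjective W.range_mkQ
  replace hs : ∀ x, W.mkQ (s x) = x := fun x => LinearMap.congr_fun hs x
  obtain hr | hr := Nat.lt_or_ge k r
  · obtain ⟨g, hg⟩ := E.subtype.exists_leftInverse_of_injective E.ker_subtype
    have hgE : ∀ x (hx : x ∈ E), (g x : V ⧸ W) = x := fun x hx =>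
      congrArg Subtype.val (LinearMap.congr_fun hg ⟨x, hx⟩)
    have hall : ∀ p : Fin (k + 1) → V, (∀ i, W.mkQ (p i) ∈ E) → ω p = 0 :=
      fun p hp => hE p fun i _ => hp i
    obtain ⟨t, ht, hωt⟩ := exists_section_apply_eq hnd hW hE hdim hs (E.subtype.comp g)
      (fun x => mem_verticalForms fun v hv => hall _ <| Fin.cases
        (by simp only [Fin.cons_zero, hs]; exact (g x).2) fun i => by
          simpa only [Fin.cons_succ, Function.comp_apply, hs] using hv i (by omega))
      (-(k : ℝ)⁻¹)
    refine ⟨t, ht, fun x => mem_verticalForms fun v hv => ?_⟩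
    have hv' : ∀ i, v i ∈ E := fun i => hv i (by omega)
    have hcons : (Fin.cons (t x) (t ∘ v) : Fin (k + 1) → V) =
        t ∘ (Fin.cons x v : Fin (k + 1) → V ⧸ W) := (Fin.comp_cons t x v).symm
    rw [contractPullback_apply, hcons, hωt, Fin.sum_univ_succ, hall (Function.update _ 0 _)]
    · have hsucc : ∀ i : Fin k, Function.update (s ∘ (Fin.cons x v : Fin (k + 1) → V ⧸ W)) i.succ
          (s (E.subtype.comp g ((Fin.cons x v : Fin (k + 1) → V ⧸ W) i.succ))) =
            s ∘ (Fin.cons x v : Fin (k + 1) → V ⧸ W) := fun i => by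
        rw [Function.update_eq_self_iff]
        simp [hgE _ (hv' i)]
      simp only [hsucc]
      have hk0 : (k : ℝ) ≠ 0 := by positivity
      simp
      field_simp
      ring
    · refine Fin.cases ?_ fun i => ?_
      · simp only [Function.update_self, hs]
        exact (g _).2
      · simpa only [Function.update_of_ne (Fin.succ_ne_zero i), Function.comp_apply, hs,
          Fin.cons_succ] using hv' i
  · refine ⟨s, hs, fun x => mem_verticalForms fun v hv => ?_⟩
    have hsnoc : ω (Fin.snoc (s ∘ v) (s x) : Fin (k + 1) → V) = 0 := hE _ <| Fin.lastCases
      (fun h => absurd h (by simp; omega)) fun i hi => by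
        simpa only [Fin.snoc_castSucc, Function.comp_apply, hs] using hv i (by simpa using hi)
    have hrot : (Fin.cons (s x) (s ∘ v) : Fin (k + 1) → V) ∘ finRotate (k + 1) =
        Fin.snoc (s ∘ v) (s x) := by
      funext i
      refine Fin.lastCases ?_ (fun i => ?_) i <;> simp
    rw [contractPullback_apply]
    have hperm := ω.map_perm (Fin.cons (s x) (s ∘ v)) (finRotate (k + 1))
    rw [hrot, hsnoc] at hperm
    exact (smul_eq_zero_iff_eq _).1 hperm.symm

end Complement

/-- Let `(V, ω, W, E)` be a multisymplectic vector space of type `(k, r)`: `ω`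
non-degenerate, `W` a `1`-Lagrangian subspace, `E ⊆ V/W` with `ι_{v₁ ∧ ⋯ ∧ v_r} ω = 0`
whenever `π (vᵢ) ∈ E` for all `i`, and `dim W = dim ⋀ᵏ_r (V/W)*`. Then `W` admits a
`k`-Lagrangian complement: there is `U ⊆ V` with `V = U ⊕ W` and `U^{⊥,k} = U`. -/
theorem exists_kLagrangian_complement {V : Type*} [AddCommGroup V] [Module ℝ V]
    [FiniteDimensional ℝ V] {k r : ℕ} (hk : 1 ≤ k)
    (ω : AlternatingMap ℝ V ℝ (Fin (k+1))) (hnd : Function.Injective ω.curryLeft)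
    (W : Submodule ℝ V) (E : Submodule ℝ (V ⧸ W))
    (hW : mPerp ω W 1 = W)
    (hE : ∀ p : Fin (k+1) → V, (∀ i : Fin (k+1), (i : ℕ) < r → W.mkQ (p i) ∈ E) → ω p = 0)
    (hdim : finrank ℝ W = finrank ℝ (verticalForms k r E)) :
    ∃ U : Submodule ℝ V, IsCompl U W ∧ mPerp ω U k = U := by
  obtain ⟨s, hs, hsv⟩ := exists_section_contractPullback_mem hk hnd hW.ge hE hdim
  obtain ⟨t, ht, hωt⟩ := exists_section_apply_eq hnd hW.ge hE hdim hs LinearMap.id hsv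
    (-((k : ℝ) + 1)⁻¹)
  have hzero : ∀ l : Fin (k + 1) → V ⧸ W, ω (t ∘ l) = 0 := fun l => by
    have hself : ∀ i, Function.update (s ∘ l) i (s (LinearMap.id (R := ℝ) (l i))) = s ∘ l :=
      fun i =>
      Function.update_eq_self i (s ∘ l)
    have hk0 : (k : ℝ) + 1 ≠ 0 := by positivity
    rw [hωt]
    simp only [hself]
    simp
    field_simp
    ring
  have hdecomp : ∀ v, v - t (W.mkQ v) ∈ W := fun v => by
    refine (Submodule.Quotient.mk_eq_zero W).1 ?_
    change W.mkQ _ = 0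
    rw [map_sub, ht, sub_self]
  have hU : LinearMap.range t ≤ mPerp ω (LinearMap.range t) k := by
    rintro _ ⟨x, rfl⟩ u hu
    choose y hy using fun i => hu i i.isLt
    obtain rfl : t ∘ y = u := funext hy
    rw [← Fin.comp_cons]
    exact hzero _
  refine ⟨LinearMap.range t, ⟨?_, ?_⟩, le_antisymm (fun v hv => ?_) hU⟩
  · rw [Submodule.disjoint_def]
    rintro _ ⟨x, rfl⟩ hx
    have hx0 : W.mkQ (t x) = 0 := (Submodule.Quotient.mk_eq_zero W).2 hx
    rw [← ht x, hx0, map_zero]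
  · rw [codisjoint_iff, eq_top_iff]
    intro v _
    exact Submodule.mem_sup.2 ⟨_, ⟨W.mkQ v, rfl⟩, _, hdecomp v, by simp⟩
  · have hw := eq_zero_of_contractPullback_eq_zero hnd hW.ge ht (hdecomp v) <| by
      ext y
      exact Submodule.sub_mem _ hv (hU ⟨W.mkQ v, rfl⟩) (t ∘ y) fun i _ => ⟨y i, rfl⟩
    exact ⟨W.mkQ v, (sub_eq_zero.1 hw).symm⟩
end

section
/- Let (V, ω, W, E) be a multisymplectic vector space of type (k, r). Then every alternating k-form on V that is vertical with respect to both W and E lies in the image of the contraction map ♭₁ : V → ⋀ᵏ V*; that is, ⋀ᵏ_{1,r} V* ⊆ ♭₁(V), where ⋀ᵏ_{1,r} V* is the set of α ∈ ⋀ᵏ V* such that ι_w α = 0 for all w ∈ W and ι_{v₁∧⋯∧v_r} α = 0 for all v₁,…,v_r ∈ V with π(v_i) ∈ E for each i (π : V → V/W the projection). -/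
open Module

/-- An alternating form with `ι_w β = 0` for all `w ∈ W` is determined by its values on the
image of a section of the projection `V → V ⧸ W`. -/
theorem AlternatingMap.eq_zero_of_compLinearMap_section {V : Type*} [AddCommGroup V] [Module ℝ V]
    {k : ℕ} (hk : 0 < k) {W : Submodule ℝ V} {s : V ⧸ W →ₗ[ℝ] V} (hs : W.mkQ ∘ₗ s = LinearMap.id)
    {β : AlternatingMap ℝ V ℝ (Fin k)} (hβ : ∀ u : Fin k → V, u ⟨0, hk⟩ ∈ W → β u = 0)
    (h : β.compLinearMap s = 0) : β = 0 := by
  have vanish (u : Fin k → V) (i : Fin k) (hu : u i ∈ W) : β u = 0 := by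
    by_cases hi : i = ⟨0, hk⟩
    · exact hβ u (hi ▸ hu)
    · have := hβ (u ∘ Equiv.swap i ⟨0, hk⟩) (by simpa using hu)
      rwa [β.map_swap u hi, neg_eq_zero] at this
  have diff_mem (x : V) : s (W.mkQ x) - x ∈ W :=
    (Submodule.Quotient.eq W).mp (LinearMap.congr_fun hs (W.mkQ x))
  ext u
  have replace_args (S : Finset (Fin k)) :
      β (S.piecewise (fun i => s (W.mkQ (u i))) u) = β u := by
    induction S using Finset.induction_on with
    | empty => simp
    | insert i S hi ih =>
      rw [← ih, Finset.piecewise_insert, ← sub_eq_zero]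
      have hself : β (S.piecewise (fun i => s (W.mkQ (u i))) u) =
          β (Function.update (S.piecewise (fun i => s (W.mkQ (u i))) u) i (u i)) := by
        congr 1
        rw [eq_comm, Function.update_eq_self_iff]
        simp [hi]
      rw [hself, ← β.map_update_sub]
      exact vanish _ i (by simpa using diff_mem (u i))
  rw [← replace_args Finset.univ, Finset.piecewise_univ]
  exact DFunLike.congr_fun h fun i => W.mkQ (u i)

theorem mem_verticalForms_iff {L : Type*} [AddCommGroup L] [Module ℝ L] {k r : ℕ} (hr : r ≠ 0)
    {E : Submodule ℝ L} {α : AlternatingMap ℝ L ℝ (Fin k)} :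
    α ∈ verticalForms k r E ↔
      ∀ v : Fin k → L, (∀ i : Fin k, (i : ℕ) < r → v i ∈ E) → α v = 0 := by
  rw [verticalForms, if_neg hr]
  rfl

/-- Let `(V, ω, W, E)` be a multisymplectic vector space of type `(k, r)`. Every
alternating `k`-form `α` on `V` that is vertical with respect to both `W`
(`ι_w α = 0` for all `w ∈ W`) and `E` (`ι_{v₁ ∧ ⋯ ∧ v_r} α = 0` whenever `π (vᵢ) ∈ E`
for all `i`) lies in the image of the contraction map `♭₁ : V → ⋀ᵏ V*`. -/
theorem vertical_forms_in_range_flat {V : Type*} [AddCommGroup V] [Module ℝ V]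
    [FiniteDimensional ℝ V] {k r : ℕ} (hk : 0 < k)
    (ω : AlternatingMap ℝ V ℝ (Fin (k+1))) (hnd : Function.Injective ω.curryLeft)
    (W : Submodule ℝ V) (E : Submodule ℝ (V ⧸ W))
    (hW : mPerp ω W 1 = W)
    (hE : ∀ p : Fin (k+1) → V, (∀ i : Fin (k+1), (i : ℕ) < r → W.mkQ (p i) ∈ E) → ω p = 0)
    (hdim : finrank ℝ W = finrank ℝ (verticalForms k r E)) :
    ∀ α : AlternatingMap ℝ V ℝ (Fin k),
      (∀ u : Fin k → V, u ⟨0, hk⟩ ∈ W → α u = 0) →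
      (∀ u : Fin k → V, (∀ i : Fin k, (i : ℕ) < r → W.mkQ (u i) ∈ E) → α u = 0) →
      ∃ v : V, ω.curryLeft v = α := by
  intro α hαW hαE
  rcases eq_or_ne r 0 with rfl | hr
  · exact ⟨0, by ext u; simp [hαE u (by simp)]⟩
  obtain ⟨s, hs⟩ := W.mkQ.exists_rightInverse_of_surjective W.range_mkQ
  have hs' (x : V ⧸ W) : W.mkQ (s x) = x := LinearMap.congr_fun hs x
  have flat_vertical (w : W) (u : Fin k → V) (hu : u ⟨0, hk⟩ ∈ W) : ω.curryLeft w u = 0 := by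
    have hw : (w : V) ∈ mPerp ω W 1 := hW.symm ▸ w.2
    refine hw u fun i hi => ?_
    rwa [show i = ⟨0, hk⟩ from Fin.ext (Nat.lt_one_iff.mp hi)]
  let Φ : W →ₗ[ℝ] verticalForms k r E :=
    LinearMap.codRestrict _
      ({ toFun := fun w => (ω.curryLeft w).compLinearMap s
         map_add' := fun w w' => by ext; simp
         map_smul' := fun c w => by ext; simp } :
        W →ₗ[ℝ] AlternatingMap ℝ (V ⧸ W) ℝ (Fin k)) fun w => by
        rw [mem_verticalForms_iff hr]
        intro v hv
        refine hE (Fin.cons (w : V) fun i => s (v i)) fun i => ?_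
        induction i using Fin.cases with
        | zero =>
          intro _
          rw [Fin.cons_zero, (LinearMap.mem_ker.mp (W.ker_mkQ.symm ▸ w.2) : W.mkQ w = 0)]
          exact E.zero_mem
        | succ i =>
          intro hi
          rw [Fin.cons_succ, hs']
          exact hv i (by rw [Fin.val_succ] at hi; omega)
  have Φ_apply (w : W) : (Φ w : AlternatingMap ℝ (V ⧸ W) ℝ (Fin k)) =
      (ω.curryLeft w).compLinearMap s := rfl
  have hinj : Function.Injective Φ := by
    rw [injective_iff_map_eq_zero]
    intro w hw
    have h0 : ω.curryLeft w = 0 :=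
      AlternatingMap.eq_zero_of_compLinearMap_section hk hs (flat_vertical w)
        (by rw [← Φ_apply, hw]; rfl)
    exact Subtype.ext (hnd (by simpa using h0))
  have : FiniteDimensional ℝ (AlternatingMap ℝ (V ⧸ W) ℝ (Fin k)) :=
    Module.Finite.of_injective (AlternatingMap.toMultilinearMapLM (S := ℝ))
      AlternatingMap.coe_multilinearMap_injective
  have hsurj : Function.Surjective Φ :=
    (LinearMap.injective_iff_surjective_of_finrank_eq_finrank (V := W)
      (V₂ := verticalForms k r E) hdim (f := Φ)).mp hinj
  obtain ⟨w, hw⟩ := hsurj ⟨α.compLinearMap s, (mem_verticalForms_iff hr).mpr fun v hv =>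
    hαE _ fun i hi => by simpa only [hs'] using hv i hi⟩
  refine ⟨w, sub_eq_zero.mp <| AlternatingMap.eq_zero_of_compLinearMap_section hk hs ?_ ?_⟩
  · intro u hu
    rw [AlternatingMap.sub_apply, flat_vertical w u hu, hαW u hu, sub_zero]
  · have hw' := congrArg Subtype.val hw
    rw [Φ_apply] at hw'
    ext v
    simpa [sub_eq_zero] using DFunLike.congr_fun hw' v
end
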